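/- Fix an integer p ≥ 0, let m_{2p}(N) = ∫_ℝ x^{2p}·ρ_N(x) dx be the even GOE moments, C_p = (2p)!/(p!·(p+1)!) the Catalan number, and write γ_p = Γ(p+1/2)/(sqrt(π)·Γ(p+1)). Then, as N → ∞ through the integers, m_{2p}(N)/N^{p+1} = C_p + 2^{2p−1}·(1 − γ_p)·N^{−1} + (1/3)·4^{p−1}·p·(−3 + (7p−1)·γ_p)·N^{−2} + (1/3)·4^{p−2}·p·(p−1)·(8p−7 − (14p−4)·γ_p)·N^{−3} + (1/45)·2^{2p−5}·p·(p−1)·(p−2)·(−15·(8p−9) + (185p²−317p+6)·γ_p)·N^{−4} + (1/45)·4^{p−4}·p·(p−1)·(p−2)·(p−3)·(320p²−1008p+487 − 4·(185p²−387p+28)·γ_p)·N^{−5} + (1/2835)·2^{2p−9}·p·(p−1)·(p−2)·(p−3)·(p−4)·(−63·(320p²−1168p+675) + 4·(6209p³−29106p²+26605p−60)·γ_p)·N^{−6} + O(N^{−7}). -/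

import Mathlib

open Nat MeasureTheory

/-- The orthonormal Hermite functions' polynomial part:
`p_n(x) = He_n(x)/√(√(2π)·n!)`, orthonormal for the weight `e^{-x²/2}` on `ℝ`. -/
noncomputable def pOrtho (n : ℕ) (x : ℝ) : ℝ :=
  Polynomial.aeval x (Polynomial.hermite n) /
    Real.sqrt (Real.sqrt (2 * Real.pi) * (n ! : ℝ))

/-- `q_n(x) = ∫_{−∞}^{x} e^{−t²/4} p_n(t) dt`. -/
noncomputable def qFun (n : ℕ) (x : ℝ) : ℝ :=
  ∫ t in Set.Iic x, Real.exp (-t ^ 2 / 4) * pOrtho n t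

/-- `D_n = π^{1/4} 2^{3/4} √((n−1)!!/n!!)`. -/
noncomputable def Dconst (n : ℕ) : ℝ :=
  Real.pi ^ ((1 : ℝ) / 4) * (2 : ℝ) ^ ((3 : ℝ) / 4) *
    Real.sqrt ((Nat.doubleFactorial (n - 1) : ℝ) / (Nat.doubleFactorial n : ℝ))

/-- `A_N = −(1/4)D_N` for even `N`, and `A_N = N^{−1/2} D_{N−1}^{−1}` for odd `N`. -/
noncomputable def Aconst (N : ℕ) : ℝ :=
  if N % 2 = 0 then -(1 / 4) * Dconst N else (Real.sqrt N)⁻¹ * (Dconst (N - 1))⁻¹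

/-- The (unscaled) GOE eigenvalue density
`ρ_N(x) = √N·(e^{−x²/2}(p_N'p_{N−1} − p_N p_{N−1}') + e^{−x²/4}((1/2)q_N + A_N)p_{N−1})`. -/
noncomputable def goeDensity (N : ℕ) (x : ℝ) : ℝ :=
  Real.sqrt N *
    (Real.exp (-x ^ 2 / 2) *
        (deriv (pOrtho N) x * pOrtho (N - 1) x - pOrtho N x * deriv (pOrtho (N - 1)) x) +
      Real.exp (-x ^ 2 / 4) * ((1 / 2) * qFun N x + Aconst N) * pOrtho (N - 1) x)

/-- The even moments `m_{2p} = ∫_ℝ x^{2p} ρ_N(x) dx` of the unscaled GOE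
eigenvalue density. -/
noncomputable def goeMoment (N p : ℕ) : ℝ :=
  ∫ x : ℝ, x ^ (2 * p) * goeDensity N x

/-- `γ_p = Γ(p+1/2)/(√π·Γ(p+1))`. -/
noncomputable def gammaRatio (p : ℕ) : ℝ :=
  Real.Gamma ((p : ℝ) + 1 / 2) / (Real.sqrt Real.pi * Real.Gamma ((p : ℝ) + 1))


open Asymptotics Filter

lemma gammaRatio_zero : gammaRatio 0 = 1 := by
  have h : Real.sqrt Real.pi ≠ 0 := (Real.sqrt_pos.2 Real.pi_pos).ne'
  unfold gammaRatio
  rw [Nat.cast_zero, zero_add, zero_add, Real.Gamma_one, Real.Gamma_one_half_eq]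
  field_simp

lemma gammaRatio_succ (p : ℕ) :
    gammaRatio (p + 1) = gammaRatio p * (2 * p + 1) / (2 * (p + 1)) := by
  have h : Real.sqrt Real.pi ≠ 0 := (Real.sqrt_pos.2 Real.pi_pos).ne'
  have h1 : (p : ℝ) + 1 ≠ 0 := by positivity
  have h2 : (p : ℝ) + 1 / 2 ≠ 0 := by positivity
  have h3 : Real.Gamma ((p : ℝ) + 1) ≠ 0 := (Real.Gamma_pos_of_pos (by positivity)).ne'
  unfold gammaRatio
  rw [Nat.cast_succ, Real.Gamma_add_one h1, show (p : ℝ) + 1 + 1 / 2 = (p + 1 / 2) + 1 by ring,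
    Real.Gamma_add_one h2]
  field_simp

lemma catalan_eq_gammaRatio (p : ℕ) :
    ((2 * p)! : ℝ) / ((p ! : ℝ) * ((p + 1)! : ℝ)) = 4 ^ p * gammaRatio p / (p + 1) := by
  induction p with
  | zero => simp [gammaRatio_zero]
  | succ p ih =>
    have h1 : (p ! : ℝ) ≠ 0 := by positivity
    rw [gammaRatio_succ, show 2 * (p + 1) = 2 * p + 1 + 1 by ring]
    simp only [Nat.factorial_succ] at ih ⊢
    push_cast at ih ⊢
    field_simp at ih ⊢
    linear_combination (4 : ℝ) * (p + 1) * ih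

open Polynomial in
/-- The normalized even GUE moments `a_{2p} / N^{p+1}` as polynomials in `N⁻¹`. -/
noncomputable def gueMomentPoly : ℕ → ℝ[X]
  | 0 => 1
  | 1 => 1
  | p + 2 => C (1 / ((p : ℝ) + 3)) * (C (2 * (2 * (p : ℝ) + 3)) * gueMomentPoly (p + 1) +
      C (((p : ℝ) + 1) * (2 * p + 1) * (2 * p + 3)) * gueMomentPoly p * X ^ 2)

open Polynomial in
/-- The difference between the normalized even GOE and GUE moments as polynomials in `N⁻¹`. -/
noncomputable def goeCorrectionPoly : ℕ → ℝ[X]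
  | 0 => 0
  | 1 => X
  | p + 2 => C 4 * goeCorrectionPoly (p + 1) - C 2 * goeCorrectionPoly (p + 1) * X +
      C (8 * ((p : ℝ) + 1) * (2 * p + 1)) * goeCorrectionPoly p * X ^ 2 +
      gueMomentPoly (p + 1) * X +
      C (6 * ((p : ℝ) + 1) * (2 * p + 1)) * gueMomentPoly p * X ^ 2

/-- The coefficient of `N^{-k}` in the normalized GUE moment, for `k ≤ 6`. -/
noncomputable def gueCoeff (p : ℝ) (g : ℝ) : ℕ → ℝ
  | 0 => g / (p + 1)
  | 2 => g * p * (p - 1) / 12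
  | 4 => g * p * (p - 1) * (p - 2) * (p - 3) * (5 * p - 2) / 1440
  | 6 => g * p * (p - 1) * (p - 2) * (p - 3) * (p - 4) * (p - 5) *
      (35 * p ^ 2 - 77 * p + 12) / 362880
  | _ => 0

/-- The coefficient of `N^{-k}` in the normalized GOE moment divided by `4^p`, for `k ≤ 6`. -/
noncomputable def goeCoeff (p : ℝ) (g : ℝ) : ℕ → ℝ
  | 0 => g / (p + 1)
  | 1 => 1 / 2 * (1 - g)
  | 2 => 1 / 12 * p * (-3 + (7 * p - 1) * g)
  | 3 => 1 / 48 * p * (p - 1) * (8 * p - 7 - (14 * p - 4) * g)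
  | 4 => 1 / 1440 * p * (p - 1) * (p - 2) *
      (-15 * (8 * p - 9) + (185 * p ^ 2 - 317 * p + 6) * g)
  | 5 => 1 / 11520 * p * (p - 1) * (p - 2) * (p - 3) *
      (320 * p ^ 2 - 1008 * p + 487 - 4 * (185 * p ^ 2 - 387 * p + 28) * g)
  | 6 => 1 / 1451520 * p * (p - 1) * (p - 2) * (p - 3) * (p - 4) *
      (-63 * (320 * p ^ 2 - 1168 * p + 675) +
        4 * (6209 * p ^ 3 - 29106 * p ^ 2 + 26605 * p - 60) * g)
  | _ => 0

open Polynomial in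
lemma coeff_gueMomentPoly (p : ℕ) {k : ℕ} (hk : k ≤ 6) :
    (gueMomentPoly p).coeff k = 4 ^ p * gueCoeff p (gammaRatio p) k := by
  induction p using Nat.twoStepInduction generalizing k with
  | zero => interval_cases k <;> simp [gueMomentPoly, gueCoeff, gammaRatio_zero, coeff_one]
  | one =>
    interval_cases k <;>
      simp [gueMomentPoly, gueCoeff, gammaRatio_zero, gammaRatio_succ, coeff_one]
    norm_num
  | more p ih0 ih1 =>
    have h3 : (p : ℝ) + 3 ≠ 0 := by positivity
    interval_cases k <;>
      simp only [gueMomentPoly, coeff_add, coeff_C_mul, coeff_mul_X_pow', ih0, ih1,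
        gueCoeff, gammaRatio_succ, Nat.reduceLeDiff, Nat.reduceSub, if_true, if_false] <;>
      push_cast <;> simp only [pow_succ] <;> field_simp <;> ring

open Polynomial in
lemma coeff_goeCorrectionPoly (p : ℕ) {k : ℕ} (hk : k ≤ 6) :
    (goeCorrectionPoly p).coeff k =
      4 ^ p * (goeCoeff p (gammaRatio p) k - gueCoeff p (gammaRatio p) k) := by
  induction p using Nat.twoStepInduction generalizing k with
  | zero => interval_cases k <;> simp [goeCorrectionPoly, goeCoeff, gueCoeff, gammaRatio_zero]
  | one =>
    interval_cases k <;>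
      simp [goeCorrectionPoly, goeCoeff, gueCoeff, gammaRatio_zero, gammaRatio_succ, coeff_X] <;>
      norm_num
  | more p ih0 ih1 =>
    have h3 : (p : ℝ) + 3 ≠ 0 := by positivity
    rcases k with - | k
    · simp [goeCorrectionPoly, coeff_X_pow, ih1, goeCoeff, gueCoeff]
    have hk5 : k ≤ 5 := by omega
    interval_cases k <;>
      simp (discharger := norm_num) only [goeCorrectionPoly, coeff_add, coeff_sub, coeff_C_mul,
        coeff_mul_X_pow', coeff_mul_X, coeff_gueMomentPoly, ih0, ih1, gueCoeff, goeCoeff,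
        gammaRatio_succ, Nat.reduceLeDiff, Nat.reduceSub, Nat.reduceAdd, if_true, if_false] <;>
      push_cast <;> simp only [pow_succ] <;> field_simp <;> ring

open Polynomial in
lemma eval_sub_sum_coeff_isBigO (P : ℝ[X]) (m : ℕ) :
    (fun N : ℕ => P.eval ((N : ℝ)⁻¹) - ∑ k ∈ Finset.range m, P.coeff k * ((N : ℝ) ^ k)⁻¹)
      =O[atTop] fun N : ℕ => ((N : ℝ) ^ m)⁻¹ := by
  have hinv : Tendsto (fun N : ℕ => ((N : ℝ))⁻¹) atTop (nhds 0) :=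
    tendsto_inv_atTop_nhds_zero_nat
  induction m generalizing P with
  | zero =>
    simpa using ((P.continuous.tendsto 0).comp hinv).isBigO_one ℝ
  | succ m ih =>
    have h := (ih P.divX).mul (isBigO_refl (fun N : ℕ => (N : ℝ)⁻¹) atTop)
    refine (h.congr_left ?_).congr_right ?_
    · intro N
      conv_rhs => rw [← P.divX_mul_X_add]
      simp only [Finset.sum_range_succ', eval_add, eval_mul, eval_X, eval_C, coeff_divX,
        sub_mul, Finset.sum_mul, pow_succ, mul_inv, coeff_add, coeff_mul_X, coeff_C_succ,
        add_zero, mul_assoc, pow_zero, inv_one, mul_one, mul_coeff_zero, coeff_X_zero, mul_zero,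
        coeff_C_zero, zero_add]
      ring
    · intro N
      rw [pow_succ, mul_inv]

lemma derivative_hermite_succ (n : ℕ) :
    Polynomial.derivative (Polynomial.hermite (n + 1)) =
      ((n : Polynomial ℤ) + 1) * Polynomial.hermite n := by
  induction n with
  | zero => simp
  | succ n ih =>
    have h := Polynomial.hermite_succ n
    rw [Polynomial.hermite_succ (n + 1), ih]
    simp only [Polynomial.derivative_sub, Polynomial.derivative_mul, Polynomial.derivative_X, ih,
      Polynomial.derivative_add, Polynomial.derivative_natCast, Polynomial.derivative_one]
    push_cast
    linear_combination -((n : Polynomial ℤ) + 1) * h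

lemma hasDerivAt_pOrtho_succ (n : ℕ) (x : ℝ) :
    HasDerivAt (pOrtho (n + 1)) (Real.sqrt (n + 1) * pOrtho n x) x := by
  have h := ((Polynomial.hermite (n + 1)).hasDerivAt_aeval x).div_const
    (Real.sqrt (Real.sqrt (2 * Real.pi) * ((n + 1)! : ℝ)))
  refine h.congr_deriv ?_
  have h1 : Real.sqrt (Real.sqrt (2 * Real.pi) * ((n + 1)! : ℝ)) =
      Real.sqrt (n + 1) * Real.sqrt (Real.sqrt (2 * Real.pi) * (n ! : ℝ)) := by
    rw [← Real.sqrt_mul (by positivity), Nat.factorial_succ]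
    push_cast
    ring_nf
  have h2 : Real.sqrt ((n : ℝ) + 1) ≠ 0 := (Real.sqrt_pos.2 (by positivity)).ne'
  have h3 : Real.sqrt ((n : ℝ) + 1) ^ 2 = n + 1 := Real.sq_sqrt (by positivity)
  have h4 : Real.sqrt (Real.sqrt (2 * Real.pi) * (n ! : ℝ)) ≠ 0 :=
    (Real.sqrt_pos.2 (by positivity)).ne'
  rw [derivative_hermite_succ, pOrtho, h1]
  simp only [map_mul, map_add, map_natCast, map_one]
  field_simp
  rw [h3, mul_comm]

lemma hasDerivAt_pOrtho (n : ℕ) (x : ℝ) :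
    HasDerivAt (pOrtho n) (x * pOrtho n x - Real.sqrt (n + 1) * pOrtho (n + 1) x) x := by
  have h := ((Polynomial.hermite n).hasDerivAt_aeval x).div_const
    (Real.sqrt (Real.sqrt (2 * Real.pi) * (n ! : ℝ)))
  refine h.congr_deriv ?_
  have h1 : Real.sqrt (Real.sqrt (2 * Real.pi) * ((n + 1)! : ℝ)) =
      Real.sqrt (n + 1) * Real.sqrt (Real.sqrt (2 * Real.pi) * (n ! : ℝ)) := by
    rw [← Real.sqrt_mul (by positivity), Nat.factorial_succ]
    push_cast
    ring_nf
  have h2 : Real.sqrt ((n : ℝ) + 1) ≠ 0 := (Real.sqrt_pos.2 (by positivity)).ne'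
  have h4 : Real.sqrt (Real.sqrt (2 * Real.pi) * (n ! : ℝ)) ≠ 0 :=
    (Real.sqrt_pos.2 (by positivity)).ne'
  rw [pOrtho, pOrtho, h1, Polynomial.hermite_succ]
  simp only [map_mul, map_sub, Polynomial.aeval_X]
  field_simp
  ring

/-- The Hermite function `e^{-x²/4} p_n(x)`. -/
noncomputable def hermiteFun (n : ℕ) (x : ℝ) : ℝ := Real.exp (-x ^ 2 / 4) * pOrtho n x

lemma hasDerivAt_exp_neg_sq_div_four (x : ℝ) :
    HasDerivAt (fun y : ℝ => Real.exp (-y ^ 2 / 4)) (-(x / 2) * Real.exp (-x ^ 2 / 4)) x := by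
  have h := (((hasDerivAt_pow 2 x).neg).div_const 4).exp
  refine h.congr_deriv ?_
  simp
  ring

lemma hasDerivAt_hermiteFun_succ (n : ℕ) (x : ℝ) :
    HasDerivAt (hermiteFun (n + 1))
      (Real.sqrt (n + 1) * hermiteFun n x - x / 2 * hermiteFun (n + 1) x) x := by
  refine ((hasDerivAt_exp_neg_sq_div_four x).mul (hasDerivAt_pOrtho_succ n x)).congr_deriv ?_
  simp only [hermiteFun]
  ring

lemma hasDerivAt_hermiteFun (n : ℕ) (x : ℝ) :
    HasDerivAt (hermiteFun n)
      (x / 2 * hermiteFun n x - Real.sqrt (n + 1) * hermiteFun (n + 1) x) x := by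
  refine ((hasDerivAt_exp_neg_sq_div_four x).mul (hasDerivAt_pOrtho n x)).congr_deriv ?_
  simp only [hermiteFun]
  ring

lemma continuous_hermiteFun (n : ℕ) : Continuous (hermiteFun n) :=
  continuous_iff_continuousAt.2 fun x => (hasDerivAt_hermiteFun n x).continuousAt

lemma integrable_eval_mul_exp_neg_mul_sq {b : ℝ} (hb : 0 < b) (P : Polynomial ℝ) :
    Integrable fun x : ℝ => P.eval x * Real.exp (-b * x ^ 2) := by
  induction P using Polynomial.induction_on' with
  | add P Q hP hQ =>
    simp only [Polynomial.eval_add, add_mul]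
    exact hP.add hQ
  | monomial k a =>
    have h := (integrable_rpow_mul_exp_neg_mul_sq hb (s := k) (by
      have : (0 : ℝ) ≤ k := k.cast_nonneg
      linarith)).const_mul a
    simpa [mul_assoc] using h

lemma integrable_pow_mul_hermiteFun (k n : ℕ) :
    Integrable fun x : ℝ => x ^ k * hermiteFun n x := by
  have h := (integrable_eval_mul_exp_neg_mul_sq (b := 1 / 4) (by norm_num)
    (Polynomial.X ^ k * (Polynomial.hermite n).map (Int.castRingHom ℝ))).div_const
    (Real.sqrt (Real.sqrt (2 * Real.pi) * (n ! : ℝ)))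
  refine h.congr (.of_forall fun x => ?_)
  simp only [hermiteFun, pOrtho, Polynomial.eval_mul, Polynomial.eval_pow, Polynomial.eval_X,
    Polynomial.eval_map, Polynomial.aeval_def, algebraMap_int_eq]
  rw [show -(1 / 4) * x ^ 2 = -x ^ 2 / 4 by ring]
  ring

lemma integrable_hermiteFun (n : ℕ) : Integrable (hermiteFun n) := by
  simpa using integrable_pow_mul_hermiteFun 0 n

lemma integrable_pow_mul_hermiteFun_mul_hermiteFun (k m n : ℕ) :
    Integrable fun x : ℝ => x ^ k * (hermiteFun m x * hermiteFun n x) := by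
  have h := (integrable_eval_mul_exp_neg_mul_sq (b := 1 / 2) (by norm_num)
    (Polynomial.X ^ k * ((Polynomial.hermite m).map (Int.castRingHom ℝ) *
      (Polynomial.hermite n).map (Int.castRingHom ℝ)))).div_const
    (Real.sqrt (Real.sqrt (2 * Real.pi) * (m ! : ℝ)) *
      Real.sqrt (Real.sqrt (2 * Real.pi) * (n ! : ℝ)))
  refine h.congr (.of_forall fun x => ?_)
  simp only [hermiteFun, pOrtho, Polynomial.eval_mul, Polynomial.eval_pow, Polynomial.eval_X,
    Polynomial.eval_map, Polynomial.aeval_def, algebraMap_int_eq]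
  rw [show -(1 / 2) * x ^ 2 = -x ^ 2 / 4 + -x ^ 2 / 4 by ring, Real.exp_add]
  ring

lemma qFun_eq (n : ℕ) (x : ℝ) : qFun n x = ∫ t in Set.Iic x, hermiteFun n t := rfl

lemma hasDerivAt_qFun (n : ℕ) (x : ℝ) : HasDerivAt (qFun n) (hermiteFun n x) x := by
  have hi := integrable_hermiteFun n
  have h : qFun n = fun y => qFun n 0 + ∫ t in (0 : ℝ)..y, hermiteFun n t := by
    funext y
    rw [← intervalIntegral.integral_Iic_sub_Iic hi.integrableOn hi.integrableOn, qFun_eq, qFun_eq]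
    ring
  rw [h]
  exact (intervalIntegral.integral_hasDerivAt_right hi.intervalIntegrable
    ((continuous_hermiteFun n).stronglyMeasurableAtFilter _ _)
    (continuous_hermiteFun n).continuousAt).const_add _

lemma continuous_qFun (n : ℕ) : Continuous (qFun n) :=
  continuous_iff_continuousAt.2 fun x => (hasDerivAt_qFun n x).continuousAt

lemma abs_qFun_le (n : ℕ) (x : ℝ) : |qFun n x| ≤ ∫ t, |hermiteFun n t| := by
  rw [qFun_eq]
  refine (abs_integral_le_integral_abs).trans ?_
  exact setIntegral_le_integral (integrable_hermiteFun n).abs (.of_forall fun _ => abs_nonneg _)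

lemma tendsto_qFun_atTop (n : ℕ) :
    Tendsto (qFun n) atTop (nhds (∫ t, hermiteFun n t)) :=
  (aecover_Iic tendsto_id).integral_tendsto_of_countably_generated (integrable_hermiteFun n)

lemma tendsto_qFun_atBot (n : ℕ) : Tendsto (qFun n) atBot (nhds 0) := by
  have hi := integrable_hermiteFun n
  have h := ((aecover_Ioi tendsto_id).integral_tendsto_of_countably_generated hi).const_sub
    (∫ t, hermiteFun n t)
  rw [sub_self] at h
  refine h.congr fun x => ?_
  rw [qFun_eq, ← intervalIntegral.integral_Iic_add_Ioi hi.integrableOn hi.integrableOn (b := x)]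
  simp

lemma integrable_qFun_mul (n : ℕ) {f : ℝ → ℝ} (hf : Integrable f) :
    Integrable fun x => qFun n x * f x :=
  hf.bdd_mul (continuous_qFun n).aestronglyMeasurable (.of_forall fun x => by
    simpa using abs_qFun_le n x)

lemma integral_combination_eq_zero {f F G H K : ℝ → ℝ} {a b c d : ℝ}
    (hderiv : ∀ x, HasDerivAt f (a * F x + b * G x + c * H x + d * K x) x)
    (hf : Integrable f) (hF : Integrable F) (hG : Integrable G) (hH : Integrable H)
    (hK : Integrable K) :
    a * (∫ x, F x) + b * (∫ x, G x) + c * (∫ x, H x) + d * (∫ x, K x) = 0 := by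
  have hab := (hF.const_mul a).add (hG.const_mul b)
  have habc := hab.add (hH.const_mul c)
  have h := integral_eq_zero_of_hasDerivAt_of_integrable hderiv (habc.add (hK.const_mul d)) hf
  have e1 := integral_add habc (hK.const_mul d)
  have e2 := integral_add hab (hH.const_mul c)
  have e3 := integral_add (hF.const_mul a) (hG.const_mul b)
  simp only [Pi.add_apply, integral_const_mul] at e1 e2 e3
  linarith

/-- The integral of `x^k` against a product of two Hermite functions. -/
noncomputable def hermitePairing (k m n : ℕ) : ℝ :=
  ∫ x : ℝ, x ^ k * (hermiteFun m x * hermiteFun n x)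

/-- The integral of `x^k φ_m(x)` against the primitive `q_N/2 + c` of `φ_N/2`. -/
noncomputable def primitivePairing (N : ℕ) (c : ℝ) (k m : ℕ) : ℝ :=
  ∫ x : ℝ, (1 / 2 * qFun N x + c) * (x ^ k * hermiteFun m x)

lemma integrable_primitivePairing (N : ℕ) (c : ℝ) (k m : ℕ) :
    Integrable fun x : ℝ => (1 / 2 * qFun N x + c) * (x ^ k * hermiteFun m x) := by
  have h := integrable_pow_mul_hermiteFun k m
  refine (((integrable_qFun_mul N h).const_mul (1 / 2)).add (h.const_mul c)).congr
    (.of_forall fun x => ?_)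
  simp only [Pi.add_apply]
  ring

lemma hermitePairing_relation_mixed (k n : ℕ) :
    k * hermitePairing (k - 1) n (n + 1) +
      Real.sqrt (n + 1) * (hermitePairing k n n - hermitePairing k (n + 1) (n + 1)) = 0 := by
  have h := integral_combination_eq_zero (a := k) (b := Real.sqrt (n + 1))
    (c := -Real.sqrt (n + 1)) (d := 0)
    (fun x => (((hasDerivAt_pow k x).mul
      ((hasDerivAt_hermiteFun n x).mul (hasDerivAt_hermiteFun_succ n x))).congr_deriv (by
        simp only [Pi.mul_apply]; ring)))
    (integrable_pow_mul_hermiteFun_mul_hermiteFun k n (n + 1))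
    (integrable_pow_mul_hermiteFun_mul_hermiteFun (k - 1) n (n + 1))
    (integrable_pow_mul_hermiteFun_mul_hermiteFun k n n)
    (integrable_pow_mul_hermiteFun_mul_hermiteFun k (n + 1) (n + 1)) (integrable_zero _ _ _)
  unfold hermitePairing
  linear_combination h

lemma hermitePairing_relation_succ (k n : ℕ) :
    k * hermitePairing (k - 1) (n + 1) (n + 1) - hermitePairing (k + 1) (n + 1) (n + 1) +
      2 * Real.sqrt (n + 1) * hermitePairing k n (n + 1) = 0 := by
  have h := integral_combination_eq_zero (a := k) (b := -1)
    (c := 2 * Real.sqrt (n + 1)) (d := 0)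
    (fun x => (((hasDerivAt_pow k x).mul
      ((hasDerivAt_hermiteFun_succ n x).mul
        (hasDerivAt_hermiteFun_succ n x))).congr_deriv (by
        simp only [Pi.mul_apply]; ring)))
    (integrable_pow_mul_hermiteFun_mul_hermiteFun k (n + 1) (n + 1))
    (integrable_pow_mul_hermiteFun_mul_hermiteFun (k - 1) (n + 1) (n + 1))
    (integrable_pow_mul_hermiteFun_mul_hermiteFun (k + 1) (n + 1) (n + 1))
    (integrable_pow_mul_hermiteFun_mul_hermiteFun k n (n + 1)) (integrable_zero _ _ _)
  unfold hermitePairing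
  linear_combination h

lemma hermitePairing_relation_self (k n : ℕ) :
    k * hermitePairing (k - 1) n n + hermitePairing (k + 1) n n -
      2 * Real.sqrt (n + 1) * hermitePairing k n (n + 1) = 0 := by
  have h := integral_combination_eq_zero (a := k) (b := 1)
    (c := -(2 * Real.sqrt (n + 1))) (d := 0)
    (fun x => (((hasDerivAt_pow k x).mul
      ((hasDerivAt_hermiteFun n x).mul (hasDerivAt_hermiteFun n x))).congr_deriv (by
        simp only [Pi.mul_apply]; ring)))
    (integrable_pow_mul_hermiteFun_mul_hermiteFun k n n)
    (integrable_pow_mul_hermiteFun_mul_hermiteFun (k - 1) n n)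
    (integrable_pow_mul_hermiteFun_mul_hermiteFun (k + 1) n n)
    (integrable_pow_mul_hermiteFun_mul_hermiteFun k n (n + 1)) (integrable_zero _ _ _)
  unfold hermitePairing
  linear_combination h

lemma primitivePairing_relation_self (c : ℝ) (k n : ℕ) :
    k * primitivePairing (n + 1) c (k - 1) n + 1 / 2 * primitivePairing (n + 1) c (k + 1) n -
      Real.sqrt (n + 1) * primitivePairing (n + 1) c k (n + 1) +
      1 / 2 * hermitePairing k n (n + 1) = 0 := by
  have h := integral_combination_eq_zero (a := k) (b := 1 / 2)
    (c := -Real.sqrt (n + 1)) (d := 1 / 2)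
    (fun x => (((((hasDerivAt_qFun (n + 1) x).const_mul (1 / 2)).add_const c).mul
      ((hasDerivAt_pow k x).mul (hasDerivAt_hermiteFun n x))).congr_deriv (by
        simp only [Pi.mul_apply]; ring)))
    (integrable_primitivePairing (n + 1) c k n)
    (integrable_primitivePairing (n + 1) c (k - 1) n)
    (integrable_primitivePairing (n + 1) c (k + 1) n)
    (integrable_primitivePairing (n + 1) c k (n + 1))
    (integrable_pow_mul_hermiteFun_mul_hermiteFun k n (n + 1))
  unfold hermitePairing primitivePairing
  linear_combination h

lemma primitivePairing_relation_succ (c : ℝ) (k n : ℕ) :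
    k * primitivePairing (n + 1) c (k - 1) (n + 1) -
      1 / 2 * primitivePairing (n + 1) c (k + 1) (n + 1) +
      Real.sqrt (n + 1) * primitivePairing (n + 1) c k n +
      1 / 2 * hermitePairing k (n + 1) (n + 1) = 0 := by
  have h := integral_combination_eq_zero (a := k) (b := -(1 / 2))
    (c := Real.sqrt (n + 1)) (d := 1 / 2)
    (fun x => (((((hasDerivAt_qFun (n + 1) x).const_mul (1 / 2)).add_const c).mul
      ((hasDerivAt_pow k x).mul (hasDerivAt_hermiteFun_succ n x))).congr_deriv (by
        simp only [Pi.mul_apply]; ring)))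
    (integrable_primitivePairing (n + 1) c k (n + 1))
    (integrable_primitivePairing (n + 1) c (k - 1) (n + 1))
    (integrable_primitivePairing (n + 1) c (k + 1) (n + 1))
    (integrable_primitivePairing (n + 1) c k n)
    (integrable_pow_mul_hermiteFun_mul_hermiteFun k (n + 1) (n + 1))
  unfold hermitePairing primitivePairing
  linear_combination h

/-- The `2p`-th GUE moment in dimension `n + 1`. -/
noncomputable def gueMoment (n p : ℕ) : ℝ :=
  (n + 1) * (hermitePairing (2 * p) n n + hermitePairing (2 * p) (n + 1) (n + 1)) -
    Real.sqrt (n + 1) * hermitePairing (2 * p + 1) n (n + 1)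

/-- The difference between the `2p`-th GOE and GUE moments in dimension `n + 1`. -/
noncomputable def goeCorrection (n p : ℕ) : ℝ :=
  Real.sqrt (n + 1) * primitivePairing (n + 1) (Aconst (n + 1)) (2 * p) n

lemma goeMoment_succ (n p : ℕ) : goeMoment (n + 1) p = gueMoment n p + goeCorrection n p := by
  have hs : Real.sqrt ((n : ℝ) + 1) ^ 2 = n + 1 := Real.sq_sqrt (by positivity)
  have i1 := ((integrable_pow_mul_hermiteFun_mul_hermiteFun (2 * p) n n).const_mul (n + 1 : ℝ))
  have i2 := ((integrable_pow_mul_hermiteFun_mul_hermiteFun (2 * p) (n + 1) (n + 1)).const_mul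
    (n + 1 : ℝ))
  have i3 := ((integrable_pow_mul_hermiteFun_mul_hermiteFun (2 * p + 1) n (n + 1)).const_mul
    (Real.sqrt (n + 1)))
  have i4 := (integrable_primitivePairing (n + 1) (Aconst (n + 1)) (2 * p) n).const_mul
    (Real.sqrt (n + 1))
  have h : ∀ x : ℝ, x ^ (2 * p) * goeDensity (n + 1) x =
      (n + 1) * (x ^ (2 * p) * (hermiteFun n x * hermiteFun n x)) +
      (n + 1) * (x ^ (2 * p) * (hermiteFun (n + 1) x * hermiteFun (n + 1) x)) -
      Real.sqrt (n + 1) * (x ^ (2 * p + 1) * (hermiteFun n x * hermiteFun (n + 1) x)) +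
      Real.sqrt (n + 1) * ((1 / 2 * qFun (n + 1) x + Aconst (n + 1)) *
        (x ^ (2 * p) * hermiteFun n x)) := by
    intro x
    rw [goeDensity, Nat.add_sub_cancel, (hasDerivAt_pOrtho_succ n x).deriv,
      (hasDerivAt_pOrtho n x).deriv, show -x ^ 2 / 2 = -x ^ 2 / 4 + -x ^ 2 / 4 by ring,
      Real.exp_add]
    simp only [hermiteFun]
    push_cast
    linear_combination x ^ (2 * p) * Real.exp (-x ^ 2 / 4) ^ 2 *
      (pOrtho n x ^ 2 + pOrtho (n + 1) x ^ 2) * hs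
  rw [goeMoment, integral_congr_ae (.of_forall h)]
  have e1 := integral_add ((i1.add i2).sub i3) i4
  have e2 := integral_sub (i1.add i2) i3
  have e3 := integral_add i1 i2
  simp only [Pi.add_apply, Pi.sub_apply, integral_const_mul] at e1 e2 e3
  simp only [gueMoment, goeCorrection, hermitePairing, primitivePairing]
  rw [e1, e2, e3]
  ring

lemma gueMoment_eq_mixed (n p : ℕ) :
    (2 * p + 1) * gueMoment n p = Real.sqrt (n + 1) * hermitePairing (2 * p + 1) n (n + 1) := by
  have hs : Real.sqrt ((n : ℝ) + 1) ^ 2 = n + 1 := Real.sq_sqrt (by positivity)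
  have h1 := hermitePairing_relation_succ (2 * p + 1) n
  have h2 := hermitePairing_relation_self (2 * p + 1) n
  have h3 := hermitePairing_relation_mixed (2 * p + 2) n
  simp only [Nat.add_sub_cancel, show 2 * p + 2 - 1 = 2 * p + 1 by omega] at h1 h2 h3
  push_cast at h1 h2 h3
  rw [gueMoment]
  linear_combination (n + 1 : ℝ) * (h1 + h2) - Real.sqrt (n + 1) * h3 +
    (hermitePairing (2 * p + 2) n n - hermitePairing (2 * p + 2) (n + 1) (n + 1)) * hs

lemma gueMoment_rec (n p : ℕ) :
    (p + 3) * gueMoment n (p + 2) = 2 * (2 * p + 3) * (n + 1) * gueMoment n (p + 1) +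
      (p + 1) * (2 * p + 1) * (2 * p + 3) * gueMoment n p := by
  have hs : Real.sqrt ((n : ℝ) + 1) ^ 2 = n + 1 := Real.sq_sqrt (by positivity)
  have a0 := gueMoment_eq_mixed n p
  have a1 := gueMoment_eq_mixed n (p + 1)
  have a2 := gueMoment_eq_mixed n (p + 2)
  have h1 := hermitePairing_relation_succ (2 * p + 3) n
  have h2 := hermitePairing_relation_self (2 * p + 3) n
  have h3 := hermitePairing_relation_mixed (2 * p + 2) n
  have d2 : gueMoment n (p + 2) = (n + 1) * (hermitePairing (2 * p + 4) n n +
    hermitePairing (2 * p + 4) (n + 1) (n + 1)) -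
    Real.sqrt (n + 1) * hermitePairing (2 * p + 5) n (n + 1) := rfl
  simp only [show 2 * p + 2 - 1 = 2 * p + 1 by omega, show 2 * p + 3 - 1 = 2 * p + 2 by omega,
    show 2 * (p + 1) + 1 = 2 * p + 3 by omega, show 2 * (p + 2) + 1 = 2 * p + 5 by omega,
    add_assoc (2 * p), Nat.reduceAdd] at a0 a1 a2 h1 h2 h3
  push_cast at a0 a1 a2 h1 h2 h3
  linear_combination 1 / 2 * (d2 + a2 + (n + 1) * (h2 - h1) - 4 * (n + 1) * a1 -
    (2 * p + 3) * Real.sqrt (n + 1) * h3 + (2 * p + 3) * (hermitePairing (2 * p + 2) n n -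
    hermitePairing (2 * p + 2) (n + 1) (n + 1)) * hs - (2 * p + 3) * (2 * p + 2) * a0)

lemma hermitePairing_zero_self (n : ℕ) : hermitePairing 0 n n = 1 := by
  induction n with
  | zero =>
    have h := integral_gaussian (1 / 2)
    rw [show Real.pi / (1 / 2) = 2 * Real.pi by ring] at h
    have h0 : Real.sqrt (2 * Real.pi) ≠ 0 := (Real.sqrt_pos.2 (by positivity)).ne'
    have h1 : ∀ x : ℝ, x ^ 0 * (hermiteFun 0 x * hermiteFun 0 x) =
        Real.exp (-(1 / 2) * x ^ 2) / Real.sqrt (2 * Real.pi) := by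
      intro x
      have h2 : Real.sqrt (Real.sqrt (2 * Real.pi)) ^ 2 = Real.sqrt (2 * Real.pi) :=
        Real.sq_sqrt (by positivity)
      rw [show -(1 / 2) * x ^ 2 = -x ^ 2 / 4 + -x ^ 2 / 4 by ring, Real.exp_add, ← h2]
      simp only [hermiteFun, pOrtho, Polynomial.hermite_zero, map_one, Nat.factorial_zero,
        Nat.cast_one, mul_one]
      ring
    rw [hermitePairing, integral_congr_ae (.of_forall h1), integral_div, h, div_self h0]
  | succ n ih =>
    have hs : Real.sqrt ((n : ℝ) + 1) ≠ 0 := (Real.sqrt_pos.2 (by positivity)).ne'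
    have h := hermitePairing_relation_mixed 0 n
    rw [Nat.cast_zero, zero_mul, zero_add, ih] at h
    have := (mul_eq_zero.1 h).resolve_left hs
    linarith

lemma gueMoment_one (n : ℕ) : gueMoment n 1 = (n + 1) * gueMoment n 0 := by
  have a0 := gueMoment_eq_mixed n 0
  have a1 := gueMoment_eq_mixed n 1
  have h1 := hermitePairing_relation_succ 1 n
  have h2 := hermitePairing_relation_self 1 n
  have z0 := hermitePairing_zero_self n
  have z1 := hermitePairing_zero_self (n + 1)
  have d1 : gueMoment n 1 = (n + 1) * (hermitePairing 2 n n +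
    hermitePairing 2 (n + 1) (n + 1)) - Real.sqrt (n + 1) * hermitePairing 3 n (n + 1) := rfl
  norm_num at a0 a1 h1 h2
  linear_combination 1 / 4 * (d1 + a1 + (n + 1) * (h2 - h1) - 4 * (n + 1) * a0 +
    (n + 1) * (z1 - z0))

lemma goeCorrection_rec (n p : ℕ) :
    goeCorrection n (p + 2) = (4 * (n + 1) - 2) * goeCorrection n (p + 1) +
      8 * (p + 1) * (2 * p + 1) * goeCorrection n p + gueMoment n (p + 1) +
      6 * (p + 1) * (2 * p + 1) * gueMoment n p := by
  have hs : Real.sqrt ((n : ℝ) + 1) ^ 2 = n + 1 := Real.sq_sqrt (by positivity)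
  have a0 := gueMoment_eq_mixed n p
  have h3 := hermitePairing_relation_mixed (2 * p + 2) n
  have r1 := primitivePairing_relation_self (Aconst (n + 1)) (2 * p + 3) n
  have r2 := primitivePairing_relation_succ (Aconst (n + 1)) (2 * p + 2) n
  have r3 := primitivePairing_relation_self (Aconst (n + 1)) (2 * p + 1) n
  have d1 : gueMoment n (p + 1) = (n + 1) * (hermitePairing (2 * p + 2) n n +
    hermitePairing (2 * p + 2) (n + 1) (n + 1)) -
    Real.sqrt (n + 1) * hermitePairing (2 * p + 3) n (n + 1) := rfl
  simp only [show 2 * p + 2 - 1 = 2 * p + 1 by omega, show 2 * p + 3 - 1 = 2 * p + 2 by omega,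
    show 2 * p + 1 - 1 = 2 * p by omega, add_assoc (2 * p), Nat.reduceAdd] at a0 r1 r2 r3 h3
  simp only [goeCorrection, mul_add 2 p, Nat.reduceMul]
  push_cast at a0 r1 r2 r3 h3
  generalize Real.sqrt ((n : ℝ) + 1) = s at *
  rw [← hs] at d1 ⊢
  linear_combination 2 * s * r1 - 4 * s ^ 2 * r2 - 8 * (p + 1) * s * r3 - d1 - s * h3 -
    6 * (p + 1) * a0

lemma goeCorrection_one (n : ℕ) :
    goeCorrection n 1 = (4 * (n + 1) - 2) * goeCorrection n 0 + gueMoment n 0 := by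
  have hs : Real.sqrt ((n : ℝ) + 1) ^ 2 = n + 1 := Real.sq_sqrt (by positivity)
  have a0 := gueMoment_eq_mixed n 0
  have h3 := hermitePairing_relation_mixed 0 n
  have r1 := primitivePairing_relation_self (Aconst (n + 1)) 1 n
  have r2 := primitivePairing_relation_succ (Aconst (n + 1)) 0 n
  have d0 : gueMoment n 0 = (n + 1) * (hermitePairing 0 n n +
    hermitePairing 0 (n + 1) (n + 1)) - Real.sqrt (n + 1) * hermitePairing 1 n (n + 1) := rfl
  simp only [Nat.cast_zero, zero_mul, mul_zero, zero_add, Nat.reduceAdd, Nat.reduceSub,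
    Nat.cast_one, one_mul] at a0 r1 r2 h3
  simp only [goeCorrection, Nat.reduceMul]
  generalize Real.sqrt ((n : ℝ) + 1) = s at *
  rw [← hs] at d0 ⊢
  linear_combination 2 * s * r1 - 4 * s ^ 2 * r2 - d0 - s * h3

lemma gueMoment_zero (n : ℕ) : gueMoment n 0 = n + 1 := by
  have a0 := gueMoment_eq_mixed n 0
  have d0 : gueMoment n 0 = (n + 1) * (hermitePairing 0 n n +
    hermitePairing 0 (n + 1) (n + 1)) - Real.sqrt (n + 1) * hermitePairing 1 n (n + 1) := rfl
  rw [hermitePairing_zero_self, hermitePairing_zero_self] at d0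
  norm_num at a0
  linarith

/-- The integral of the product of `φ_n` with the primitive `q_m` of `φ_m`. -/
noncomputable def qPairing (m n : ℕ) : ℝ := ∫ x : ℝ, qFun m x * hermiteFun n x

lemma qPairing_add_swap (m n : ℕ) :
    qPairing m n + qPairing n m = (∫ x, hermiteFun m x) * ∫ x, hermiteFun n x := by
  have i1 := integrable_qFun_mul m (integrable_hermiteFun n)
  have i2 := integrable_qFun_mul n (integrable_hermiteFun m)
  have h := integral_of_hasDerivAt_of_tendsto
    (fun x => ((hasDerivAt_qFun m x).mul (hasDerivAt_qFun n x)).congr_deriv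
      (show _ = qFun m x * hermiteFun n x + qFun n x * hermiteFun m x by ring)) (i1.add i2)
    ((tendsto_qFun_atBot m).mul (tendsto_qFun_atBot n))
    ((tendsto_qFun_atTop m).mul (tendsto_qFun_atTop n))
  rw [integral_add i1 i2] at h
  rw [qPairing, qPairing, h]
  ring

lemma hasDerivAt_hermiteFun_zero (x : ℝ) :
    HasDerivAt (hermiteFun 0) (-(1 / 2) * hermiteFun 1 x) x := by
  have h1 := hasDerivAt_hermiteFun 0 x
  refine h1.congr_deriv ?_
  have h2 : hermiteFun 1 x = x * hermiteFun 0 x := by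
    simp only [hermiteFun, pOrtho, Polynomial.hermite_one, Polynomial.hermite_zero]
    simp
    ring
  simp [h2]
  ring

lemma hasDerivAt_hermiteFun_succ_ladder (n : ℕ) (x : ℝ) :
    HasDerivAt (hermiteFun (n + 1)) (1 / 2 * Real.sqrt (n + 1) * hermiteFun n x -
      1 / 2 * Real.sqrt ((n + 1 : ℕ) + 1) * hermiteFun (n + 2) x) x := by
  have h1 := hasDerivAt_hermiteFun (n + 1) x
  have h2 := hasDerivAt_hermiteFun_succ n x
  refine h1.congr_deriv ?_
  have h3 := h1.unique h2
  linear_combination 1 / 2 * h3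

lemma sqrt_mul_integral_hermiteFun_add_two (n : ℕ) :
    Real.sqrt ((n + 1 : ℕ) + 1) * ∫ x, hermiteFun (n + 2) x =
      Real.sqrt (n + 1) * ∫ x, hermiteFun n x := by
  have h := integral_combination_eq_zero (a := 1 / 2 * Real.sqrt (n + 1))
    (b := -(1 / 2 * Real.sqrt ((n + 1 : ℕ) + 1))) (c := 0) (d := 0)
    (fun x => (hasDerivAt_hermiteFun_succ_ladder n x).congr_deriv (by ring))
    (integrable_hermiteFun _) (integrable_hermiteFun n) (integrable_hermiteFun (n + 2))
    (integrable_zero _ _ _) (integrable_zero _ _ _)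
  linear_combination -2 * h

lemma integral_hermiteFun_of_odd {n : ℕ} (hn : Odd n) : ∫ x, hermiteFun n x = 0 := by
  obtain ⟨k, rfl⟩ := hn
  induction k with
  | zero =>
    have h := integral_combination_eq_zero (a := -(1 / 2)) (b := 0) (c := 0) (d := 0)
      (fun x => (hasDerivAt_hermiteFun_zero x).congr_deriv (by ring))
      (integrable_hermiteFun _) (integrable_hermiteFun 1)
      (integrable_zero _ _ _) (integrable_zero _ _ _) (integrable_zero _ _ _)
    simpa using h
  | succ k ih =>
    have h := sqrt_mul_integral_hermiteFun_add_two (2 * k + 1)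
    rw [ih, mul_zero] at h
    exact (mul_eq_zero.1 h).resolve_left (Real.sqrt_pos.2 (by positivity)).ne'

lemma Dconst_pos (n : ℕ) : 0 < Dconst n := by
  unfold Dconst
  have h1 := Nat.doubleFactorial_pos n
  have h2 := Nat.doubleFactorial_pos (n - 1)
  positivity

lemma sqrt_mul_Dconst_add_two (n : ℕ) :
    Real.sqrt ((n + 1 : ℕ) + 1) * Dconst (n + 2) = Real.sqrt (n + 1) * Dconst n := by
  have h1 : ((n + 1)‼ : ℝ) = (n + 1) * ((n - 1)‼ : ℝ) := by
    rcases n with - | n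
    · simp
    · rw [Nat.doubleFactorial_add_two, Nat.add_sub_cancel]
      push_cast
      ring
  have h0 : ((n)‼ : ℝ) ≠ 0 := by
    have := Nat.doubleFactorial_pos n
    positivity
  have h2 : Real.sqrt ((n + 1 : ℕ) + 1) * Real.sqrt (((n + 1)‼ : ℝ) / ((n + 2)‼ : ℝ)) =
      Real.sqrt (n + 1) * Real.sqrt (((n - 1)‼ : ℝ) / (n ‼ : ℝ)) := by
    rw [← Real.sqrt_mul (by positivity), ← Real.sqrt_mul (by positivity), h1,
      Nat.doubleFactorial_add_two]
    congr 1
    push_cast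
    have : (n : ℝ) + 2 ≠ 0 := by positivity
    have : (n : ℝ) + 1 + 1 ≠ 0 := by positivity
    field_simp
    ring
  unfold Dconst
  rw [show n + 2 - 1 = n + 1 by omega]
  linear_combination Real.pi ^ ((1 : ℝ) / 4) * (2 : ℝ) ^ ((3 : ℝ) / 4) * h2

lemma integral_hermiteFun_zero : ∫ x, hermiteFun 0 x = Dconst 0 := by
  have h := integral_gaussian (1 / 4)
  have h1 : ∀ x : ℝ, hermiteFun 0 x =
      Real.exp (-(1 / 4) * x ^ 2) / Real.sqrt (Real.sqrt (2 * Real.pi)) := by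
    intro x
    rw [show -(1 / 4) * x ^ 2 = -x ^ 2 / 4 by ring]
    simp only [hermiteFun, pOrtho, Polynomial.hermite_zero, map_one, Nat.factorial_zero,
      Nat.cast_one, mul_one]
    ring
  rw [integral_congr_ae (.of_forall h1), integral_div, h]
  refine (pow_left_inj₀ (by positivity) (Dconst_pos 0).le (four_ne_zero)).1 ?_
  have e1 : Real.sqrt (Real.sqrt (2 * Real.pi)) ^ 4 = 2 * Real.pi := by
    rw [show 4 = 2 * 2 by rfl, pow_mul, Real.sq_sqrt (by positivity),
      Real.sq_sqrt (by positivity)]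
  have e2 : Real.sqrt (Real.pi / (1 / 4)) ^ 4 = (Real.pi / (1 / 4)) ^ 2 := by
    rw [show 4 = 2 * 2 by rfl, pow_mul, Real.sq_sqrt (by positivity)]
  have e3 : (Real.pi ^ ((1 : ℝ) / 4)) ^ 4 = Real.pi := by
    rw [← Real.rpow_natCast, ← Real.rpow_mul Real.pi_pos.le]
    norm_num
  have e4 : ((2 : ℝ) ^ ((3 : ℝ) / 4)) ^ 4 = 8 := by
    rw [← Real.rpow_natCast, ← Real.rpow_mul two_pos.le]
    norm_num
  rw [div_pow, e1, e2]
  simp only [Dconst, mul_pow, e3, e4]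
  have := Real.pi_ne_zero
  simp
  field_simp
  norm_num

lemma integral_hermiteFun_of_even {n : ℕ} (hn : Even n) : ∫ x, hermiteFun n x = Dconst n := by
  obtain ⟨k, rfl⟩ := hn
  induction k with
  | zero => exact integral_hermiteFun_zero
  | succ k ih =>
    have h := sqrt_mul_integral_hermiteFun_add_two (k + k)
    rw [ih, ← sqrt_mul_Dconst_add_two] at h
    rw [show k + 1 + (k + 1) = k + k + 2 by ring]
    exact mul_left_cancel₀ (Real.sqrt_pos.2 (by positivity)).ne' h

lemma sqrt_mul_qPairing_succ (n : ℕ) :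
    Real.sqrt (n + 1) * qPairing (n + 1) n = if Even n then -2 else 0 := by
  induction n with
  | zero =>
    have h := integral_combination_eq_zero (a := -(1 / 2)) (b := 1) (c := 0) (d := 0)
      (fun x => ((hasDerivAt_qFun 0 x).mul (hasDerivAt_hermiteFun_zero x)).congr_deriv (by ring))
      (integrable_qFun_mul 0 (integrable_hermiteFun 0))
      (integrable_qFun_mul 0 (integrable_hermiteFun 1))
      (integrable_pow_mul_hermiteFun_mul_hermiteFun 0 0 0)
      (integrable_zero _ _ _) (integrable_zero _ _ _)
    have h1 := hermitePairing_zero_self 0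
    have h2 := qPairing_add_swap 0 1
    rw [integral_hermiteFun_of_odd odd_one] at h2
    unfold hermitePairing at h1
    unfold qPairing at *
    simp only [CharP.cast_eq_zero, zero_add, Real.sqrt_one, Even.zero, if_true]
    linear_combination h2 + 2 * h - 2 * h1
  | succ n ih =>
    have h := integral_combination_eq_zero (a := 1 / 2 * Real.sqrt (n + 1))
      (b := -(1 / 2 * Real.sqrt ((n + 1 : ℕ) + 1))) (c := 1) (d := 0)
      (fun x => ((hasDerivAt_qFun (n + 1) x).mul
        (hasDerivAt_hermiteFun_succ_ladder n x)).congr_deriv (by ring))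
      (integrable_qFun_mul (n + 1) (integrable_hermiteFun (n + 1)))
      (integrable_qFun_mul (n + 1) (integrable_hermiteFun n))
      (integrable_qFun_mul (n + 1) (integrable_hermiteFun (n + 2)))
      (integrable_pow_mul_hermiteFun_mul_hermiteFun 0 (n + 1) (n + 1))
      (integrable_zero _ _ _)
    have h1 := hermitePairing_zero_self (n + 1)
    have h2 := qPairing_add_swap (n + 1) (n + 2)
    have h3 : (∫ x, hermiteFun (n + 1) x) * ∫ x, hermiteFun (n + 2) x = 0 := by
      rcases Nat.even_or_odd n with hn | hn
      · rw [integral_hermiteFun_of_odd hn.add_one, zero_mul]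
      · rw [integral_hermiteFun_of_odd (n := n + 2) (by simpa [parity_simps] using hn), mul_zero]
    rw [h3] at h2
    unfold hermitePairing at h1
    unfold qPairing at *
    have h4 : (if Even (n + 1) then (-2 : ℝ) else 0) = -(if Even n then -2 else 0) - 2 := by
      by_cases hn : Even n <;> simp [hn, parity_simps]
    rw [h4, ← ih]
    linear_combination Real.sqrt ((n + 1 : ℕ) + 1) * h2 + 2 * h - 2 * h1

lemma goeCorrection_zero (n : ℕ) : goeCorrection n 0 = 0 := by
  have hs : Real.sqrt ((n : ℝ) + 1) ≠ 0 := (Real.sqrt_pos.2 (by positivity)).ne'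
  have hI := integrable_hermiteFun n
  have h1 : primitivePairing (n + 1) (Aconst (n + 1)) 0 n =
      1 / 2 * qPairing (n + 1) n + Aconst (n + 1) * ∫ x, hermiteFun n x := by
    rw [qPairing, ← integral_const_mul, ← integral_const_mul, ← integral_add
      ((integrable_qFun_mul _ hI).const_mul _) (hI.const_mul _), primitivePairing]
    congr 1
    funext x
    ring
  have h2 := sqrt_mul_qPairing_succ n
  rw [goeCorrection, mul_zero, h1]
  rcases Nat.even_or_odd n with hn | hn
  · rw [if_pos hn] at h2
    have hA : Aconst (n + 1) = (Real.sqrt (n + 1))⁻¹ * (Dconst n)⁻¹ := by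
      have : (n + 1) % 2 ≠ 0 := by
        have := Nat.even_iff.1 hn
        omega
      rw [Aconst, if_neg this]
      simp
    have hD := (Dconst_pos n).ne'
    rw [integral_hermiteFun_of_even hn, hA]
    have h3 : Real.sqrt ((n : ℝ) + 1) * ((Real.sqrt (n + 1))⁻¹ * (Dconst n)⁻¹ * Dconst n) = 1 := by
      field_simp
    linear_combination 1 / 2 * h2 + h3
  · rw [if_neg (Nat.not_even_iff_odd.2 hn)] at h2
    rw [integral_hermiteFun_of_odd hn]
    linear_combination 1 / 2 * h2

lemma gueMoment_eq_eval (n p : ℕ) :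
    gueMoment n p = (n + 1 : ℝ) ^ (p + 1) * (gueMomentPoly p).eval ((n + 1 : ℝ)⁻¹) := by
  have hn : (n : ℝ) + 1 ≠ 0 := by positivity
  induction p using Nat.twoStepInduction with
  | zero => simp [gueMomentPoly, gueMoment_zero]
  | one =>
    simp only [gueMomentPoly, gueMoment_zero, gueMoment_one, Polynomial.eval_one]
    ring
  | more p ih0 ih1 =>
    have hp : (p : ℝ) + 3 ≠ 0 := by positivity
    have h := gueMoment_rec n p
    rw [ih0, ih1] at h
    apply mul_left_cancel₀ hp
    rw [h]
    simp only [gueMomentPoly, Polynomial.eval_mul, Polynomial.eval_add, Polynomial.eval_C,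
      Polynomial.eval_pow, Polynomial.eval_X]
    field_simp
    ring

lemma goeCorrection_eq_eval (n p : ℕ) :
    goeCorrection n p = (n + 1 : ℝ) ^ (p + 1) * (goeCorrectionPoly p).eval ((n + 1 : ℝ)⁻¹) := by
  have hn : (n : ℝ) + 1 ≠ 0 := by positivity
  induction p using Nat.twoStepInduction with
  | zero => simp [goeCorrectionPoly, goeCorrection_zero]
  | one =>
    simp only [goeCorrectionPoly, goeCorrection_zero, goeCorrection_one, gueMoment_zero,
      Polynomial.eval_X]
    field_simp
    ring
  | more p ih0 ih1 =>
    rw [goeCorrection_rec, ih0, ih1, gueMoment_eq_eval, gueMoment_eq_eval]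
    simp only [goeCorrectionPoly, Polynomial.eval_mul, Polynomial.eval_add, Polynomial.eval_sub,
      Polynomial.eval_C, Polynomial.eval_pow, Polynomial.eval_X]
    field_simp
    ring

lemma goeMoment_div_eq_eval {N : ℕ} (hN : N ≠ 0) (p : ℕ) :
    goeMoment N p / (N : ℝ) ^ (p + 1) =
      (gueMomentPoly p + goeCorrectionPoly p).eval ((N : ℝ)⁻¹) := by
  obtain ⟨n, rfl⟩ := Nat.exists_eq_succ_of_ne_zero hN
  have hn : (n : ℝ) + 1 ≠ 0 := by positivity
  rw [Nat.succ_eq_add_one, goeMoment_succ, gueMoment_eq_eval, goeCorrection_eq_eval,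
    Polynomial.eval_add]
  push_cast
  field_simp

lemma coeff_gueMomentPoly_add_goeCorrectionPoly (p : ℕ) {k : ℕ} (hk : k ≤ 6) :
    (gueMomentPoly p + goeCorrectionPoly p).coeff k =
      4 ^ p * goeCoeff p (gammaRatio p) k := by
  rw [Polynomial.coeff_add, coeff_gueMomentPoly p hk, coeff_goeCorrectionPoly p hk]
  ring

/-- Large-`N` asymptotic expansion of the even GOE moments up to and
including the term of order `N^{−6}`, with error `O(N^{−7})`. -/
theorem goeMoment_largeN (p : ℕ) :
    (fun N : ℕ =>
        goeMoment N p / (N : ℝ) ^ (p + 1) -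
          (((2 * p)! : ℝ) / ((p ! : ℝ) * ((p + 1)! : ℝ)) +
            (2 : ℝ) ^ (2 * (p : ℤ) - 1) * (1 - gammaRatio p) * ((N : ℝ))⁻¹ +
            (1 / 3) * (4 : ℝ) ^ ((p : ℤ) - 1) * (p : ℝ) *
              (-3 + (7 * (p : ℝ) - 1) * gammaRatio p) * ((N : ℝ) ^ 2)⁻¹ +
            (1 / 3) * (4 : ℝ) ^ ((p : ℤ) - 2) * (p : ℝ) * ((p : ℝ) - 1) *
              (8 * (p : ℝ) - 7 - (14 * (p : ℝ) - 4) * gammaRatio p) * ((N : ℝ) ^ 3)⁻¹ +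
            (1 / 45) * (2 : ℝ) ^ (2 * (p : ℤ) - 5) * (p : ℝ) * ((p : ℝ) - 1) * ((p : ℝ) - 2) *
              (-15 * (8 * (p : ℝ) - 9) +
                (185 * (p : ℝ) ^ 2 - 317 * (p : ℝ) + 6) * gammaRatio p) * ((N : ℝ) ^ 4)⁻¹ +
            (1 / 45) * (4 : ℝ) ^ ((p : ℤ) - 4) * (p : ℝ) * ((p : ℝ) - 1) * ((p : ℝ) - 2) *
              ((p : ℝ) - 3) *
              (320 * (p : ℝ) ^ 2 - 1008 * (p : ℝ) + 487 -
                4 * (185 * (p : ℝ) ^ 2 - 387 * (p : ℝ) + 28) * gammaRatio p) * ((N : ℝ) ^ 5)⁻¹ +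
            (1 / 2835) * (2 : ℝ) ^ (2 * (p : ℤ) - 9) * (p : ℝ) * ((p : ℝ) - 1) * ((p : ℝ) - 2) *
              ((p : ℝ) - 3) * ((p : ℝ) - 4) *
              (-63 * (320 * (p : ℝ) ^ 2 - 1168 * (p : ℝ) + 675) +
                4 * (6209 * (p : ℝ) ^ 3 - 29106 * (p : ℝ) ^ 2 + 26605 * (p : ℝ) - 60) *
                  gammaRatio p) * ((N : ℝ) ^ 6)⁻¹)) =O[atTop]
      fun N : ℕ => ((N : ℝ) ^ 7)⁻¹ := by
  refine (eval_sub_sum_coeff_isBigO (gueMomentPoly p + goeCorrectionPoly p) 7).congr' ?_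
    EventuallyEq.rfl
  filter_upwards [eventually_ne_atTop 0] with N hN
  have h2 : ∀ m : ℤ, (2 : ℝ) ^ (2 * (p : ℤ) - m) = 4 ^ p / 2 ^ m := by
    intro m
    rw [zpow_sub₀ two_ne_zero, zpow_mul, zpow_natCast]
    norm_num
  have h4 : ∀ m : ℤ, (4 : ℝ) ^ ((p : ℤ) - m) = 4 ^ p / 4 ^ m := by
    intro m
    rw [zpow_sub₀ four_ne_zero, zpow_natCast]
  rw [goeMoment_div_eq_eval hN, catalan_eq_gammaRatio]
  simp (discharger := norm_num) only [Finset.sum_range_succ, Finset.sum_range_zero,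
    coeff_gueMomentPoly_add_goeCorrectionPoly, goeCoeff, h2, h4]
  norm_num
  ring
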